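/- Let F = F(x^1,…,x^N) satisfy the commutativity equations F_i F_j = F_j F_i for all i,j. Fix i₀ and suppose the (N−1)×N matrix P = (F_{i₀ i j}) (rows i ≠ i₀) has rank N−1. Then the matrix B with entries B_{ij} = Σ_k A^k F_{kij}, where A^k = (−1)^{k+1} det P_k, is proportional to the identity matrix: B = h·Id for some scalar function h. -/

import Mathlib

open scoped BigOperators

noncomputable def pd {N : ℕ} (i : Fin N) (f : (Fin N → ℂ) → ℂ) : (Fin N → ℂ) → ℂ :=
  fun x => fderiv ℂ f x (Pi.single i 1)

noncomputable def D3 {N : ℕ} (F : (Fin N → ℂ) → ℂ) (i p q : Fin N) (x : Fin N → ℂ) : ℂ :=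
  pd i (pd p (pd q F)) x

noncomputable def Fmat {N : ℕ} (F : (Fin N → ℂ) → ℂ) (i : Fin N) (x : Fin N → ℂ) :
    Matrix (Fin N) (Fin N) ℂ :=
  Matrix.of fun p q => D3 F i p q x

/-- The `(N−1)×N` matrix `P = (F_{i₀ i j})` with rows indexed by `i ≠ i₀`
(in increasing order) and columns by `j = 1,…,N`. -/
noncomputable def Pmat {n : ℕ} (F : (Fin (n + 1) → ℂ) → ℂ) (i₀ : Fin (n + 1))
    (x : Fin (n + 1) → ℂ) : Matrix (Fin n) (Fin (n + 1)) ℂ :=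
  Matrix.of fun i j => D3 F i₀ (i₀.succAbove i) j x

/-- `A^k = (−1)^{k+1} det P_k` (with the 1-based sign convention of the paper,
so `(−1)^{k}` for the 0-based index `k`), where `P_k` is `P` with the `k`-th
column removed. -/
noncomputable def Acoef {n : ℕ} (F : (Fin (n + 1) → ℂ) → ℂ) (i₀ : Fin (n + 1))
    (x : Fin (n + 1) → ℂ) (k : Fin (n + 1)) : ℂ :=
  (-1 : ℂ) ^ (k : ℕ) *
    (Matrix.of fun i j : Fin n => Pmat F i₀ x i (k.succAbove j)).det

/-- The matrix `B` with entries `B_{ij} = Σ_k A^k F_{kij}`. -/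
noncomputable def Bmat {n : ℕ} (F : (Fin (n + 1) → ℂ) → ℂ) (i₀ : Fin (n + 1))
    (x : Fin (n + 1) → ℂ) : Matrix (Fin (n + 1)) (Fin (n + 1)) ℂ :=
  Matrix.of fun i j => ∑ k, Acoef F i₀ x k * D3 F k i j x

theorem contDiff_pd {N : ℕ} {f : (Fin N → ℂ) → ℂ} (hf : ContDiff ℂ ⊤ f) (i : Fin N) :
    ContDiff ℂ ⊤ (pd i f) :=
  (hf.fderiv_right (m := ⊤) le_top).clm_apply contDiff_const

theorem pd_pd_apply {N : ℕ} {f : (Fin N → ℂ) → ℂ} (hf : ContDiff ℂ ⊤ f) (i j : Fin N)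
    (x : Fin N → ℂ) :
    pd i (pd j f) x = fderiv ℂ (fderiv ℂ f) x (Pi.single i 1) (Pi.single j 1) := by
  have hd : DifferentiableAt ℂ (fderiv ℂ f) x :=
    (hf.fderiv_right (m := ⊤) le_top).differentiable (by simp) x
  change fderiv ℂ (fun y => fderiv ℂ f y (Pi.single j 1)) x (Pi.single i 1) = _
  rw [fderiv_clm_apply hd (differentiableAt_const _)]
  simp

/-- Partial derivatives of a smooth function commute. -/
theorem pd_comm {N : ℕ} {f : (Fin N → ℂ) → ℂ} (hf : ContDiff ℂ ⊤ f) (i j : Fin N) :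
    pd i (pd j f) = pd j (pd i f) := by
  funext x
  rw [pd_pd_apply hf, pd_pd_apply hf]
  exact (hf.contDiffAt.isSymmSndFDerivAt le_top) _ _

theorem D3_swap_left {N : ℕ} {F : (Fin N → ℂ) → ℂ} (hF : ContDiff ℂ ⊤ F) (i p q : Fin N)
    (x : Fin N → ℂ) : D3 F i p q x = D3 F p i q x := by
  rw [D3, D3, pd_comm (contDiff_pd hF q)]

theorem D3_swap_right {N : ℕ} {F : (Fin N → ℂ) → ℂ} (hF : ContDiff ℂ ⊤ F) (i p q : Fin N)
    (x : Fin N → ℂ) : D3 F i p q x = D3 F i q p x := by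
  rw [D3, D3, pd_comm hF p q]

theorem D3_rotate {N : ℕ} {F : (Fin N → ℂ) → ℂ} (hF : ContDiff ℂ ⊤ F) (i p q : Fin N)
    (x : Fin N → ℂ) : D3 F i p q x = D3 F p q i x := by
  rw [D3_swap_left hF, D3_swap_right hF]

/-- The signed maximal minors of an `n × (n + 1)` matrix form a vector in its kernel. -/
theorem sum_signed_minor_mul_eq_zero {R : Type*} [CommRing R] {n : ℕ}
    (M : Matrix (Fin n) (Fin (n + 1)) R) (i : Fin n) :
    ∑ k : Fin (n + 1), (-1) ^ (k : ℕ) * (Matrix.of fun a b : Fin n => M a (k.succAbove b)).det *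
      M i k = 0 := by
  have hdet : (Matrix.of (Fin.cons (M i) M : Fin (n + 1) → Fin (n + 1) → R)).det = 0 :=
    Matrix.det_zero_of_row_eq (Fin.succ_ne_zero i).symm rfl
  rw [Matrix.det_succ_row_zero] at hdet
  rw [← hdet]
  exact Finset.sum_congr rfl fun k _ => mul_right_comm _ _ _

theorem Bmat_eq_sum {n : ℕ} (F : (Fin (n + 1) → ℂ) → ℂ) (i₀ : Fin (n + 1))
    (x : Fin (n + 1) → ℂ) : Bmat F i₀ x = ∑ k, Acoef F i₀ x k • Fmat F k x := by
  ext i j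
  simp [Bmat, Fmat, Matrix.sum_apply]

/-- Off the diagonal, the column `i₀` of `B` vanishes. -/
theorem Bmat_succAbove {n : ℕ} {F : (Fin (n + 1) → ℂ) → ℂ} (hF : ContDiff ℂ ⊤ F)
    (i₀ : Fin (n + 1)) (x : Fin (n + 1) → ℂ) (i : Fin n) :
    Bmat F i₀ x (i₀.succAbove i) i₀ = 0 := by
  simp only [Bmat, Matrix.of_apply]
  rw [← sum_signed_minor_mul_eq_zero (Pmat F i₀ x) i]
  refine Finset.sum_congr rfl fun k _ => ?_
  rw [D3_rotate hF, D3_swap_left hF]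
  rfl

/-- `B` is proportional to the identity matrix. -/
theorem stmt13 {n : ℕ} (F : (Fin (n + 1) → ℂ) → ℂ) (hF : ContDiff ℂ ⊤ F)
    (hcomm : ∀ x, ∀ i j : Fin (n + 1), Fmat F i x * Fmat F j x = Fmat F j x * Fmat F i x)
    (i₀ : Fin (n + 1)) (x : Fin (n + 1) → ℂ)
    (hrank : (Pmat F i₀ x).rank = n) :
    ∃ h : ℂ, Bmat F i₀ x = h • (1 : Matrix (Fin (n + 1)) (Fin (n + 1)) ℂ) := by
  set h := Bmat F i₀ x i₀ i₀ with hh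
  refine ⟨h, ?_⟩
  have hcol (r : Fin (n + 1)) :
      Bmat F i₀ x r i₀ = h * (1 : Matrix (Fin (n + 1)) (Fin (n + 1)) ℂ) r i₀ := by
    rcases Fin.eq_self_or_eq_succAbove i₀ r with rfl | ⟨i, rfl⟩
    · simp [hh]
    · simp [Bmat_succAbove hF]
  have hBcomm (q : Fin (n + 1)) : Bmat F i₀ x * Fmat F q x = Fmat F q x * Bmat F i₀ x := by
    simp only [Bmat_eq_sum, Finset.sum_mul, Finset.mul_sum, smul_mul_assoc, mul_smul_comm,
      hcomm x _ q]
  have hFcol (p q : Fin (n + 1)) : Fmat F i₀ x p q = Fmat F q x p i₀ := by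
    simp only [Fmat, Matrix.of_apply]
    rw [D3_rotate hF, D3_swap_left hF]
  have hBF : Bmat F i₀ x * Fmat F i₀ x = h • Fmat F i₀ x := by
    ext r q
    calc (Bmat F i₀ x * Fmat F i₀ x) r q = (Bmat F i₀ x * Fmat F q x) r i₀ := by
          simp only [Matrix.mul_apply, hFcol]
      _ = (Fmat F q x * Bmat F i₀ x) r i₀ := by rw [hBcomm]
      _ = (h • Fmat F i₀ x) r q := by
          simp [Matrix.mul_apply, hcol, Matrix.one_apply, hFcol r q, mul_comm]
  have hC : (Bmat F i₀ x - h • 1) * Fmat F i₀ x = 0 := by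
    rw [sub_mul, hBF, smul_mul_assoc, one_mul, sub_self]
  have hC₀ (r : Fin (n + 1)) :
      (Bmat F i₀ x - h • (1 : Matrix (Fin (n + 1)) (Fin (n + 1)) ℂ)) r i₀ = 0 := by
    simp [hcol]
  have hli : LinearIndependent ℂ (Pmat F i₀ x).row := by
    rw [linearIndependent_iff_card_eq_finrank_span, Set.finrank, ← Matrix.rank_eq_finrank_span_row,
      hrank, Fintype.card_fin]
  rw [← sub_eq_zero]
  ext r s
  rcases Fin.eq_self_or_eq_succAbove i₀ s with rfl | ⟨i, rfl⟩
  · exact hC₀ r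
  · refine Fintype.linearIndependent_iff.mp hli
      (fun i => (Bmat F i₀ x - h • 1) r (i₀.succAbove i)) ?_ i
    ext q
    have hrq := congrFun (congrFun hC r) q
    rw [Matrix.mul_apply, Fin.sum_univ_succAbove _ i₀, hC₀, zero_mul, zero_add] at hrq
    simpa [Fmat, Pmat] using hrq
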